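/- arXiv:2504.07201 — 4 statements merged into one kernel-verified Lean document; each statement's English description precedes it below -/
import Mathlib

section
/- Let r ≥ 1 be odd and let y₁,…,y_r ∈ ℂ satisfy y_i y_k ≠ 1 for all 1 ≤ i < k ≤ r. Then Σ_{j=1}^{r} (−1)^{j−1} ∏_{1 ≤ i < k ≤ r, i ≠ j, k ≠ j} (y_i − y_k)/(y_i y_k − 1) = ∏_{1 ≤ i < k ≤ r} (y_i − y_k)/(y_i y_k − 1). -/
open Finset Polynomial in
/-- The residue identity behind the theorem: partial fractions of
`∏ i, (z * y i - 1) / ((z ^ 2 - 1) * ∏ i, (z - y i))`. -/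
theorem sum_prod_mul_sub_one_div_sub {ι K : Type*} [Fintype ι] [DecidableEq ι] [Field K]
    [CharZero K] (hodd : Odd (Fintype.card ι)) (y : ι → K) (hy : Function.Injective y)
    (h1 : ∀ i, y i ≠ 1) (hn : ∀ i, y i ≠ -1) :
    ∑ j, ∏ i ∈ univ.erase j, (y j * y i - 1) / (y j - y i) = 1 := by
  let v : Option (Option ι) → K := fun o => o.elim 1 fun o => o.elim (-1) y
  have hv : Function.Injective v := by
    rintro (_ | _ | i) (_ | _ | j) h
    · rfl
    · exact absurd (show (1 : K) = -1 from h) (by norm_num)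
    · exact absurd h.symm (h1 j)
    · exact absurd (show (-1 : K) = 1 from h) (by norm_num)
    · rfl
    · exact absurd h.symm (hn j)
    · exact absurd h (h1 i)
    · exact absurd h (hn i)
    · rw [hy h]
  let P : K[X] := ∏ i, (C (y i) * X - 1)
  have hP : P.natDegree ≤ Fintype.card ι := by
    refine (natDegree_prod_le _ _).trans ((sum_le_card_nsmul _ _ 1 fun i _ => ?_).trans (by simp))
    compute_degree
  have hcard : #(univ : Finset (Option (Option ι))) = Fintype.card ι + 2 := by simp
  have hdeg : P.degree < #(univ : Finset (Option (Option ι))) :=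
    degree_le_natDegree.trans_lt (by rw [hcard]; exact_mod_cast by omega)
  have hsum := Lagrange.coeff_eq_sum (hv.injOn (s := (univ : Finset (Option (Option ι))))) hdeg
  rw [hcard, coeff_eq_zero_of_natDegree_lt (by omega)] at hsum
  have herase : ∀ (a : Option (Option ι)), ∏ b ∈ univ.erase a, (v a - v b) =
      ∏ b, if b = a then 1 else v a - v b := by
    intro a
    rw [← mul_prod_erase univ _ (mem_univ a), if_pos rfl, one_mul]
    exact prod_congr rfl fun b hb => (if_neg (ne_of_mem_erase hb)).symm
  have hone : P.eval 1 = - ∏ i, (1 - y i) := by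
    have : ∏ i, (1 - y i) = ∏ i, ((-1) * (y i - 1)) := prod_congr rfl fun i _ => by ring
    rw [this, prod_mul_distrib, prod_const, card_univ, hodd.neg_one_pow]
    simp [P, eval_prod]
  have hneg : P.eval (-1) = ∏ i, (-1 - y i) := by
    simp only [P, eval_prod]
    exact prod_congr rfl fun i _ => by simp; ring
  have hterm : ∀ j, P.eval (y j) / ∏ b ∈ univ.erase (some (some j)), (v (some (some j)) - v b) =
      ∏ i ∈ univ.erase j, (y j * y i - 1) / (y j - y i) := by
    intro j
    have hE : ∏ i, (if i = j then 1 else y j - y i) = ∏ i ∈ univ.erase j, (y j - y i) := by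
      rw [← mul_prod_erase univ _ (mem_univ j), if_pos rfl, one_mul]
      exact prod_congr rfl fun b hb => if_neg (ne_of_mem_erase hb)
    have hPj : P.eval (y j) = (y j * y j - 1) * ∏ i ∈ univ.erase j, (y j * y i - 1) := by
      rw [mul_prod_erase univ (fun i => y j * y i - 1) (mem_univ j)]
      simp only [P, eval_prod, eval_sub, eval_mul, eval_C, eval_X, eval_one]
      exact prod_congr rfl fun i _ => by ring
    have ha := sub_ne_zero.2 (h1 j)
    have hb := sub_ne_zero.2 (hn j)
    rw [herase, Fintype.prod_option, Fintype.prod_option, hPj, prod_div_distrib]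
    simp only [v, Option.elim, reduceCtorEq, if_false, Option.some.injEq]
    rw [hE, ← mul_assoc, show y j * y j - 1 = (y j - 1) * (y j - -1) by ring,
      mul_div_mul_left _ _ (mul_ne_zero ha hb)]
  have h1' : ∏ i, (1 - y i) ≠ 0 := prod_ne_zero_iff.2 fun i _ => sub_ne_zero.2 (h1 i).symm
  have hn' : ∏ i, (-1 - y i) ≠ 0 := prod_ne_zero_iff.2 fun i _ => sub_ne_zero.2 (hn i).symm
  rw [Fintype.sum_option, Fintype.sum_option] at hsum
  have hs : ∑ i, P.eval (v (some (some i))) /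
      ∏ b ∈ univ.erase (some (some i)), (v (some (some i)) - v b) =
      ∑ j, ∏ i ∈ univ.erase j, (y j * y i - 1) / (y j - y i) := sum_congr rfl fun j _ => hterm j
  rw [hs, herase, herase, Fintype.prod_option, Fintype.prod_option, Fintype.prod_option,
    Fintype.prod_option] at hsum
  simp only [v, Option.elim, reduceCtorEq, if_false, if_true, Option.some.injEq, hone, hneg]
    at hsum
  field_simp at hsum
  linear_combination (1 / 4 : K) * hsum

open Finset in
/-- Deleting one index from a product of an antisymmetric function over increasing pairs. -/
theorem prod_lt_eq_neg_one_pow_mul_prod_lt_ne {R : Type*} [CommRing R] {r : ℕ}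
    (f : Fin r → Fin r → R) (hf : ∀ i k, f i k = -f k i) (j : Fin r) :
    ∏ p ∈ univ.filter (fun p : Fin r × Fin r => p.1 < p.2), f p.1 p.2 =
      (-1) ^ (j : ℕ) * (∏ i ∈ univ.erase j, f j i) *
        ∏ p ∈ univ.filter (fun p : Fin r × Fin r => p.1 < p.2 ∧ p.1 ≠ j ∧ p.2 ≠ j),
          f p.1 p.2 := by
  rw [← prod_filter_mul_prod_filter_not _ (fun p : Fin r × Fin r => p.1 ≠ j ∧ p.2 ≠ j),
    filter_filter, filter_filter, mul_comm]
  congr 1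
  have hsign : ∏ i ∈ univ.erase j, (if i < j then (-1 : R) else 1) = (-1) ^ (j : ℕ) := by
    rw [prod_ite, prod_const, prod_const_one, mul_one]
    congr 1
    have : (univ.erase j).filter (fun i => i < j) = Iio j := by
      ext i; simp only [mem_filter, mem_erase, mem_univ, mem_Iio]; grind
    rw [this, Fin.card_Iio]
  rw [← hsign, ← prod_mul_distrib]
  refine prod_bij' (fun p _ => if p.1 = j then p.2 else p.1)
    (fun i _ => if i < j then (i, j) else (j, i)) ?_ ?_ ?_ ?_ ?_
  · rintro ⟨a, b⟩ h
    simp only [mem_filter, mem_erase, mem_univ] at h ⊢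
    grind
  · intro i h
    simp only [mem_filter, mem_erase, mem_univ] at h ⊢
    grind
  · rintro ⟨a, b⟩ h
    simp only [mem_filter, mem_univ] at h ⊢
    grind
  · intro i h
    simp only [mem_erase, mem_univ] at h ⊢
    grind
  · rintro ⟨a, b⟩ h
    simp only [mem_filter, mem_univ, true_and] at h ⊢
    by_cases ha : a = j
    · subst ha
      simp [h.1.not_gt]
    · have hb : b = j := by grind
      subst hb
      simp [ha, h.1, hf a b]

open Finset in
/-- The theorem for pairwise distinct `y i` different from `1` and `-1`. -/
theorem alternating_sum_odd_of_injective (r : ℕ) (hodd : Odd r) (y : Fin r → ℂ)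
    (hy : Function.Injective y) (h1 : ∀ i, y i ≠ 1) (hn : ∀ i, y i ≠ -1)
    (h : ∀ i k : Fin r, i < k → y i * y k ≠ 1) :
    ∑ j : Fin r, (-1 : ℂ) ^ (j : ℕ) *
        ∏ p ∈ Finset.univ.filter
            (fun p : Fin r × Fin r => p.1 < p.2 ∧ p.1 ≠ j ∧ p.2 ≠ j),
          (y p.1 - y p.2) / (y p.1 * y p.2 - 1) =
      ∏ p ∈ Finset.univ.filter (fun p : Fin r × Fin r => p.1 < p.2),
        (y p.1 - y p.2) / (y p.1 * y p.2 - 1) := by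
  refine Eq.trans ?_ ((congrArg _ (sum_prod_mul_sub_one_div_sub (by simpa using hodd) y hy h1
    hn)).trans (mul_one _))
  rw [mul_sum]
  refine sum_congr rfl fun j _ => ?_
  rw [prod_lt_eq_neg_one_pow_mul_prod_lt_ne (fun i k => (y i - y k) / (y i * y k - 1))
    (fun i k => by rw [mul_comm (y k), ← neg_div, neg_sub]) j]
  have hinv : (∏ i ∈ univ.erase j, (y j - y i) / (y j * y i - 1)) *
      ∏ i ∈ univ.erase j, (y j * y i - 1) / (y j - y i) = 1 := by
    rw [← prod_mul_distrib]
    refine prod_eq_one fun i hi => ?_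
    have hij := ne_of_mem_erase hi
    have ha : y j - y i ≠ 0 := sub_ne_zero.2 fun e => hij (hy e).symm
    have hb : y j * y i - 1 ≠ 0 := sub_ne_zero.2 <| by
      rcases hij.lt_or_gt with hlt | hlt
      · rw [mul_comm]; exact h i j hlt
      · exact h j i hlt
    rw [div_mul_div_comm, mul_comm (y j - y i), div_self (mul_ne_zero hb ha)]
  linear_combination (-(-1 : ℂ) ^ (j : ℕ) * ∏ p ∈ univ.filter
    (fun p : Fin r × Fin r => p.1 < p.2 ∧ p.1 ≠ j ∧ p.2 ≠ j),
      (y p.1 - y p.2) / (y p.1 * y p.2 - 1)) * hinv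

open Filter Topology in
theorem eventually_nhdsWithin_compl_ne {X : Type*} [TopologicalSpace X] [T1Space X] (x a : X) :
    ∀ᶠ t in 𝓝[≠] x, t ≠ a := by
  rcases eq_or_ne x a with rfl | hxa
  · exact self_mem_nhdsWithin
  · exact eventually_ne_nhdsWithin hxa


/-- for odd `r ≥ 1` and `y₁, …, y_r ∈ ℂ` with `y_i y_k ≠ 1` for `i < k`,
`Σ_{j=1}^r (-1)^{j-1} ∏_{i<k, i≠j, k≠j} (y_i - y_k)/(y_i y_k - 1)
  = ∏_{i<k} (y_i - y_k)/(y_i y_k - 1)`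
(indices `0`-based: the paper's `y_j` is `y ⟨j-1⟩`, and `(-1)^{j-1}` becomes `(-1)^j`). -/
theorem alternating_sum_odd (r : ℕ) (hr : 1 ≤ r) (hodd : Odd r) (y : Fin r → ℂ)
    (h : ∀ i k : Fin r, i < k → y i * y k ≠ 1) :
    ∑ j : Fin r, (-1 : ℂ) ^ (j : ℕ) *
        ∏ p ∈ Finset.univ.filter
            (fun p : Fin r × Fin r => p.1 < p.2 ∧ p.1 ≠ j ∧ p.2 ≠ j),
          (y p.1 - y p.2) / (y p.1 * y p.2 - 1) =
      ∏ p ∈ Finset.univ.filter (fun p : Fin r × Fin r => p.1 < p.2),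
        (y p.1 - y p.2) / (y p.1 * y p.2 - 1) := by
  let Y : ℂ → Fin r → ℂ := fun t i => y i + t * ((i : ℕ) + 1)
  have hY0 : Y 0 = y := by funext i; simp [Y]
  have hYc : ∀ i, Continuous fun t => Y t i := fun i => by fun_prop
  have hden : ∀ i k, i < k → Y 0 i * Y 0 k - 1 ≠ 0 := fun i k hik => by
    rw [hY0]; exact sub_ne_zero.2 (h i k hik)
  have hfc : ∀ i k, i < k →
      ContinuousAt (fun t => (Y t i - Y t k) / (Y t i * Y t k - 1)) 0 := fun i k hik =>
    ((hYc i).sub (hYc k)).continuousAt.div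
      (((hYc i).mul (hYc k)).sub continuous_const).continuousAt (hden i k hik)
  have havoid : ∀ (i : Fin r) (c : ℂ), ∀ᶠ t in nhdsWithin (0 : ℂ) {0}ᶜ, Y t i ≠ c := by
    intro i c
    filter_upwards [eventually_nhdsWithin_compl_ne 0 ((c - y i) / ((i : ℕ) + 1))] with t ht hc
    exact ht ((eq_div_iff (Nat.cast_add_one_ne_zero _)).2 (by rw [← hc]; simp [Y]))
  have hinj : ∀ᶠ t in nhdsWithin (0 : ℂ) {0}ᶜ, ∀ i k : Fin r, Y t i = Y t k → i = k := by
    refine Filter.eventually_all.2 fun i => Filter.eventually_all.2 fun k => ?_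
    rcases eq_or_ne i k with hik | hik
    · exact Filter.Eventually.of_forall fun _ _ => hik
    have hne : ((i : ℕ) : ℂ) - (k : ℕ) ≠ 0 :=
      sub_ne_zero.2 fun e => hik (Fin.ext (Nat.cast_injective e))
    filter_upwards [eventually_nhdsWithin_compl_ne 0 ((y k - y i) / ((i : ℕ) - (k : ℕ)))]
      with t ht hc
    exact absurd ((eq_div_iff hne).2 (by linear_combination (hc : y i + _ = y k + _))) ht
  have hprod : ∀ᶠ t in nhdsWithin (0 : ℂ) {0}ᶜ, ∀ i k : Fin r, i < k → Y t i * Y t k ≠ 1 := by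
    refine Filter.Eventually.filter_mono nhdsWithin_le_nhds ?_
    refine Filter.eventually_all.2 fun i => Filter.eventually_all.2 fun k => ?_
    by_cases hik : i < k
    · filter_upwards [((hYc i).mul (hYc k)).continuousAt.eventually_ne
        (sub_ne_zero.1 (hden i k hik))] with t ht _ using ht
    · exact Filter.Eventually.of_forall fun _ hlt => absurd hlt hik
  have hL : ContinuousAt (fun t => ∑ j : Fin r, (-1 : ℂ) ^ (j : ℕ) *
      ∏ p ∈ Finset.univ.filter
          (fun p : Fin r × Fin r => p.1 < p.2 ∧ p.1 ≠ j ∧ p.2 ≠ j),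
        (Y t p.1 - Y t p.2) / (Y t p.1 * Y t p.2 - 1)) 0 :=
    tendsto_finsetSum _ fun j _ => tendsto_const_nhds.mul <| tendsto_finsetProd _ fun p hp =>
      hfc p.1 p.2 (Finset.mem_filter.1 hp).2.1
  have hR : ContinuousAt (fun t =>
      ∏ p ∈ Finset.univ.filter (fun p : Fin r × Fin r => p.1 < p.2),
        (Y t p.1 - Y t p.2) / (Y t p.1 * Y t p.2 - 1)) 0 :=
    tendsto_finsetProd _ fun p hp => hfc p.1 p.2 (Finset.mem_filter.1 hp).2
  have key := tendsto_nhds_unique_of_eventuallyEq (hL.tendsto.mono_left nhdsWithin_le_nhds)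
    (hR.tendsto.mono_left nhdsWithin_le_nhds) (l := nhdsWithin (0 : ℂ) {0}ᶜ) <| by
      filter_upwards [hinj, hprod, Filter.eventually_all.2 fun i => havoid i 1,
        Filter.eventually_all.2 fun i => havoid i (-1)] with t hi hp h1 hn
      exact alternating_sum_odd_of_injective r hodd (Y t) (fun i k => hi i k) h1 hn hp
  simpa only [hY0] using key
end

section
/- Let r ≥ 2 be even and let y₁,…,y_r ∈ ℂ satisfy y_i y_k ≠ 1 for all 1 ≤ i < k ≤ r. Then Σ_{j=2}^{r} (−1)^{j} · (y₁ − y_j)/(y₁ y_j − 1) · ∏_{1 ≤ i < k ≤ r, i ∉ {1,j}, k ∉ {1,j}} (y_i − y_k)/(y_i y_k − 1) = ∏_{1 ≤ i < k ≤ r} (y_i − y_k)/(y_i y_k − 1). -/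
open Filter Topology

open Polynomial in
/-- A partial fraction identity, obtained from Lagrange interpolation at the nodes
`1`, `-1`, `x⁻¹` and the elements of `Z`. -/
theorem sum_prod_div_eq_prod_div {F : Type*} [Field F] [DecidableEq F] (h2 : (2 : F) ≠ 0)
    (Z : Finset F) (hodd : Odd Z.card) (x : F) (hx0 : x ≠ 0) (hx1 : x ≠ 1) (hx2 : x ≠ -1)
    (hz1 : ∀ z ∈ Z, z ≠ 1) (hz2 : ∀ z ∈ Z, z ≠ -1) (hxz : ∀ z ∈ Z, x * z ≠ 1) :
    ∑ z ∈ Z, (x - z) / (x * z - 1) * ∏ w ∈ Z.erase z, (w * z - 1) / (w - z) =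
      ∏ z ∈ Z, (x - z) / (x * z - 1) := by
  have hneg : (1 : F) ≠ -1 := fun h => h2 (by linear_combination h)
  have ha1 : x⁻¹ ≠ 1 := by simpa using hx1
  have ha2 : x⁻¹ ≠ -1 := fun h => hx2 (by rw [← inv_inv x, h]; norm_num)
  have hxa : x * x⁻¹ = 1 := mul_inv_cancel₀ hx0
  have haZ : x⁻¹ ∉ Z := fun h => hxz _ h hxa
  have h1Z : (1 : F) ∉ Z := fun h => hz1 _ h rfl
  have h2Z : (-1 : F) ∉ Z := fun h => hz2 _ h rfl
  have hm2 : (-1 : F) ∉ insert x⁻¹ Z := by simp [ha2.symm, h2Z]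
  have hm1 : (1 : F) ∉ insert (-1) (insert x⁻¹ Z) := by simp [ha1.symm, h1Z, hneg]
  set S : Finset F := insert 1 (insert (-1) (insert x⁻¹ Z)) with hS
  have hcard : S.card = Z.card + 3 := by
    rw [hS, Finset.card_insert_of_notMem hm1, Finset.card_insert_of_notMem hm2,
      Finset.card_insert_of_notMem haZ]
  let P : F[X] := (C x - X) * ∏ w ∈ Z, (1 - C w * X)
  have hP : P.natDegree ≤ Z.card + 1 := by
    have hlin : (C x - X : F[X]).natDegree ≤ 1 := by compute_degree
    have hprod : (∏ w ∈ Z, (1 - C w * X) : F[X]).natDegree ≤ Z.card := by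
      refine (natDegree_prod_le _ _).trans ?_
      refine (Finset.sum_le_card_nsmul _ _ 1 fun w _ => ?_).trans (by simp)
      compute_degree
    exact natDegree_mul_le.trans (by omega)
  have heval : ∀ t, P.eval t = (x - t) * ∏ w ∈ Z, (1 - w * t) := fun t => by
    simp [P, eval_prod]
  have key : ∑ t ∈ S, P.eval t / ∏ w ∈ S.erase t, (t - w) = 0 := by
    have hdeg : P.degree < S.card := by
      refine degree_le_natDegree.trans_lt ?_
      rw [hcard]
      exact_mod_cast (by omega : P.natDegree < Z.card + 3)
    have := Lagrange.coeff_eq_sum (s := S) (v := id) (Set.injOn_id _) hdeg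
    rw [coeff_eq_zero_of_natDegree_lt (by omega)] at this
    exact this.symm
  have hone : P.eval 1 / ∏ w ∈ S.erase 1, (1 - w) = x / 2 := by
    rw [hS, Finset.erase_insert hm1, Finset.prod_insert hm2, Finset.prod_insert haZ, heval]
    have hne : ∏ w ∈ Z, (1 - w) ≠ 0 :=
      Finset.prod_ne_zero_iff.2 fun w hw => sub_ne_zero.2 (hz1 w hw).symm
    have : x - 1 ≠ 0 := sub_ne_zero.2 hx1
    have h3 : (1 : F) - x⁻¹ = (x - 1) / x := by field_simp
    have h4 : (1 : F) - -1 = 2 := by norm_num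
    simp only [mul_one]
    rw [h3, h4]
    field_simp
  have hnegone : P.eval (-1) / ∏ w ∈ S.erase (-1), (-1 - w) = -(x / 2) := by
    rw [hS, Finset.erase_insert_of_ne hneg, Finset.erase_insert hm2,
      Finset.prod_insert (by simp [ha1.symm, h1Z]), Finset.prod_insert haZ, heval]
    have hne : ∏ w ∈ Z, (1 + w) ≠ 0 :=
      Finset.prod_ne_zero_iff.2 fun w hw h => hz2 w hw (by linear_combination h)
    have hp : ∏ w ∈ Z, (-1 - w) = -∏ w ∈ Z, (1 + w) := by
      rw [Finset.prod_congr rfl fun (w : F) _ => (by ring : (-1 : F) - w = -1 * (1 + w)),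
        Finset.prod_mul_distrib, Finset.prod_const, hodd.neg_one_pow, neg_one_mul]
    have hq : ∏ w ∈ Z, (1 - w * -1) = ∏ w ∈ Z, (1 + w) :=
      Finset.prod_congr rfl fun w _ => by ring
    have : x + 1 ≠ 0 := fun h => hx2 (by linear_combination h)
    have h3 : (-1 : F) - x⁻¹ = -(x + 1) / x := by field_simp; ring
    have h4 : (-1 : F) - 1 = -2 := by norm_num
    rw [hp, hq, h3, h4]
    field_simp
    ring
  have hinv : P.eval x⁻¹ / ∏ w ∈ S.erase x⁻¹, (x⁻¹ - w) =
      x * ∏ z ∈ Z, (x - z) / (x * z - 1) := by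
    rw [hS, Finset.erase_insert_of_ne ha1.symm, Finset.erase_insert_of_ne ha2.symm,
      Finset.erase_insert haZ, Finset.prod_insert (by simp [hneg, h1Z]),
      Finset.prod_insert h2Z, heval]
    have hp : (∏ w ∈ Z, (1 - w * x⁻¹)) / ∏ w ∈ Z, (x⁻¹ - w) =
        -∏ z ∈ Z, (x - z) / (x * z - 1) := by
      rw [← Finset.prod_div_distrib, ← neg_one_mul, ← hodd.neg_one_pow, ← Finset.prod_const,
        ← Finset.prod_mul_distrib]
      refine Finset.prod_congr rfl fun w hw => ?_
      have h1 : x * w - 1 ≠ 0 := sub_ne_zero.2 (hxz w hw)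
      have h3 : x⁻¹ - w = -(x * w - 1) / x := by field_simp; ring
      rw [h3]
      field_simp
    have hm : x - 1 ≠ 0 := sub_ne_zero.2 hx1
    have hpl : x + 1 ≠ 0 := fun h => hx2 (by linear_combination h)
    have h3 : x⁻¹ - 1 = -(x - 1) / x := by field_simp; ring
    have h4 : x⁻¹ - -1 = (x + 1) / x := by field_simp; ring
    have h5 : (x - x⁻¹) / ((x⁻¹ - 1) * (x⁻¹ - -1)) = -x := by
      rw [h3, h4]
      field_simp
      ring
    rw [← mul_assoc, mul_div_mul_comm, h5, hp]
    ring
  have hnode : ∀ z ∈ Z, P.eval z / ∏ w ∈ S.erase z, (z - w) =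
      -x * ((x - z) / (x * z - 1) * ∏ w ∈ Z.erase z, (w * z - 1) / (w - z)) := by
    intro z hz
    have hza : x⁻¹ ≠ z := fun h => haZ (h ▸ hz)
    rw [hS, Finset.erase_insert_of_ne (hz1 z hz).symm, Finset.erase_insert_of_ne (hz2 z hz).symm,
      Finset.erase_insert_of_ne hza,
      Finset.prod_insert (by simp [hneg, h1Z, ha1.symm]),
      Finset.prod_insert (by simp [h2Z, ha2.symm]), Finset.prod_insert (by simp [haZ]), heval,
      ← Finset.mul_prod_erase Z _ hz]
    have hp : (∏ w ∈ Z.erase z, (1 - w * z)) / ∏ w ∈ Z.erase z, (z - w) =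
        ∏ w ∈ Z.erase z, (w * z - 1) / (w - z) := by
      rw [← Finset.prod_div_distrib]
      refine Finset.prod_congr rfl fun w _ => ?_
      rw [← neg_sub (w * z) 1, ← neg_sub w z, neg_div_neg_eq]
    have hm : z - 1 ≠ 0 := sub_ne_zero.2 (hz1 z hz)
    have hpl : z + 1 ≠ 0 := fun h => hz2 z hz (by linear_combination h)
    have h1 : x * z - 1 ≠ 0 := sub_ne_zero.2 (hxz z hz)
    have h3 : z - x⁻¹ = (x * z - 1) / x := by field_simp
    have h4 : z - -1 = z + 1 := by ring
    have h5 : (x - z) * (1 - z * z) / ((z - 1) * ((z - -1) * (z - x⁻¹))) =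
        -x * ((x - z) / (x * z - 1)) := by
      rw [h3, h4]
      field_simp
      ring
    rw [← mul_assoc, ← mul_assoc, ← mul_assoc, mul_assoc (z - 1), mul_div_mul_comm, h5, hp]
    ring
  rw [Finset.sum_insert hm1, Finset.sum_insert hm2, Finset.sum_insert haZ, hone, hnegone, hinv,
    Finset.sum_congr rfl hnode, ← Finset.mul_sum] at key
  refine mul_left_cancel₀ hx0 ?_
  linear_combination -key

/-- Splitting off the factors that involve `j` from a product over increasing pairs. -/
theorem prod_lt_pairs_eq_mul_erase {ι M : Type*} [LinearOrder ι] [CommMonoid M]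
    (f : ι → ι → M) (S : Finset ι) {j : ι} (hj : j ∈ S) :
    ∏ p ∈ S ×ˢ S with p.1 < p.2, f p.1 p.2 =
      (∏ i ∈ S.erase j, if i < j then f i j else f j i) *
        ∏ p ∈ S.erase j ×ˢ S.erase j with p.1 < p.2, f p.1 p.2 := by
  simp only [Finset.prod_filter, Finset.prod_product]
  rw [← Finset.mul_prod_erase S _ hj, ← Finset.mul_prod_erase S _ hj,
    Finset.prod_congr rfl fun i _ =>
      (Finset.mul_prod_erase S (fun k => if i < k then f i k else 1) hj).symm,
    Finset.prod_mul_distrib, if_neg (lt_irrefl j), one_mul, ← mul_assoc,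
    ← Finset.prod_mul_distrib]
  congr 1
  refine Finset.prod_congr rfl fun i hi => ?_
  rcases lt_or_gt_of_ne (Finset.ne_of_mem_erase hi) with h | h
  · simp [h, h.not_gt]
  · simp [h, h.not_gt]

theorem card_filter_not_lt_erase_zero_erase {n : ℕ} (j : Fin (n + 1)) :
    (((Finset.univ.erase 0).erase j).filter (fun i => ¬ i < j)).card = n - j := by
  have : ((Finset.univ.erase 0).erase j).filter (fun i => ¬ i < j) = Finset.Ioi j := by
    ext i
    simp only [Finset.mem_filter, Finset.mem_erase, Finset.mem_univ, and_true, Finset.mem_Ioi,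
      not_lt]
    constructor
    · rintro ⟨⟨h1, -⟩, h2⟩
      exact lt_of_le_of_ne h2 (Ne.symm h1)
    · intro h
      exact ⟨⟨h.ne', (lt_of_le_of_lt (Fin.zero_le j) h).ne'⟩, h.le⟩
  rw [this, Fin.card_Ioi]
  omega

/-- The expansion with sums and products over increasing pairs in explicit finite sets, for
points in general position. -/
theorem alternating_sum_of_generic {n : ℕ} (hn : Odd n) (y : Fin (n + 1) → ℂ)
    (h : ∀ i k, i ≠ k → y i * y k ≠ 1) (hinj : Function.Injective y) (h0 : y 0 ≠ 0)
    (h1 : ∀ i, y i ≠ 1) (h2 : ∀ i, y i ≠ -1) :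
    ∑ j ∈ Finset.univ.erase (0 : Fin (n + 1)),
        (-1 : ℂ) ^ ((j : ℕ) + 1) * ((y 0 - y j) / (y 0 * y j - 1)) *
          ∏ p ∈ ((Finset.univ.erase 0).erase j) ×ˢ ((Finset.univ.erase 0).erase j)
            with p.1 < p.2, (y p.1 - y p.2) / (y p.1 * y p.2 - 1) =
      ∏ p ∈ (Finset.univ : Finset (Fin (n + 1))) ×ˢ Finset.univ with p.1 < p.2,
        (y p.1 - y p.2) / (y p.1 * y p.2 - 1) := by
  let f : Fin (n + 1) → Fin (n + 1) → ℂ := fun i k => (y i - y k) / (y i * y k - 1)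
  set U : Finset (Fin (n + 1)) := Finset.univ.erase 0 with hU
  have hanti : ∀ i k, f k i = -1 * f i k := fun i k => by
    simp only [f]
    rw [mul_comm (y k), ← neg_sub (y i), neg_div, neg_one_mul]
  have hcore : ∑ j ∈ U, f 0 j * ∏ i ∈ U.erase j, (f i j)⁻¹ = ∏ j ∈ U, f 0 j := by
    have := sum_prod_div_eq_prod_div two_ne_zero (U.image y)
      (by rw [Finset.card_image_of_injective _ hinj, hU]; simpa using hn) (y 0) h0 (h1 0) (h2 0)
      (by simpa using fun i _ => h1 i) (by simpa using fun i _ => h2 i)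
      (by simpa [hU] using fun i hi => h 0 i (Ne.symm hi))
    simp only [Finset.sum_image hinj.injOn, Finset.prod_image hinj.injOn,
      ← Finset.image_erase hinj] at this
    simpa [f] using this
  have hU0 : ∏ p ∈ (Finset.univ : Finset (Fin (n + 1))) ×ˢ Finset.univ with p.1 < p.2,
      f p.1 p.2 = (∏ j ∈ U, f 0 j) * ∏ p ∈ U ×ˢ U with p.1 < p.2, f p.1 p.2 := by
    rw [prod_lt_pairs_eq_mul_erase f Finset.univ (Finset.mem_univ 0)]
    simp [hU]
  change ∑ j ∈ U, (-1 : ℂ) ^ ((j : ℕ) + 1) * f 0 j *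
    ∏ p ∈ (U.erase j) ×ˢ (U.erase j) with p.1 < p.2, f p.1 p.2 = _
  refine Eq.trans ?_ hU0.symm
  rw [← hcore, Finset.sum_mul]
  refine Finset.sum_congr rfl fun j hj => ?_
  rw [prod_lt_pairs_eq_mul_erase f U hj]
  have hsign : (∏ i ∈ U.erase j, if i < j then f i j else f j i) =
      (-1) ^ ((j : ℕ) + 1) * ∏ i ∈ U.erase j, f i j := by
    have hpow : (-1 : ℂ) ^ ((j : ℕ) + 1) = ∏ i ∈ U.erase j, if i < j then 1 else -1 := by
      rw [Finset.prod_ite, Finset.prod_const_one, one_mul, Finset.prod_const,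
        card_filter_not_lt_erase_zero_erase j]
      have : (j : ℕ) ≤ n := by omega
      obtain ⟨m, hm⟩ := hn
      refine neg_one_pow_congr ?_
      simp only [Nat.even_iff]
      omega
    rw [hpow, ← Finset.prod_mul_distrib]
    refine Finset.prod_congr rfl fun i _ => ?_
    split_ifs
    · rw [one_mul]
    · exact hanti i j
  have hne : ∏ i ∈ U.erase j, f i j ≠ 0 := Finset.prod_ne_zero_iff.2 fun i hi => by
    have hij : i ≠ j := Finset.ne_of_mem_erase hi
    exact div_ne_zero (sub_ne_zero.2 (hinj.ne hij)) (sub_ne_zero.2 (h i j hij))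
  rw [hsign, Finset.prod_inv_distrib]
  field_simp

theorem eventually_add_mul_ne (a b c : ℂ) (hb : b ≠ 0) :
    ∀ᶠ e in 𝓝[≠] (0 : ℂ), a + e * b ≠ c := by
  by_cases h : a = c
  · filter_upwards [self_mem_nhdsWithin] with e he
    simpa [h] using ⟨he, hb⟩
  · have hc : ContinuousAt (fun e : ℂ => a + e * b) 0 := by fun_prop
    exact (hc.eventually_ne (by simpa using h)).filter_mono nhdsWithin_le_nhds

/-- for even `r ≥ 2` and `y₁, …, y_r ∈ ℂ` with `y_i y_k ≠ 1` for `i < k`,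
`Σ_{j=2}^r (-1)^j (y₁ - y_j)/(y₁ y_j - 1) ∏_{i<k, i,k ∉ {1,j}} (y_i - y_k)/(y_i y_k - 1)
  = ∏_{i<k} (y_i - y_k)/(y_i y_k - 1)`
(indices `0`-based: the paper's `y_j` is `y ⟨j-1⟩`, so the sign `(-1)^j` becomes
`(-1)^{j+1}` for `j = 1, …, r-1`). -/
theorem alternating_sum_even (r : ℕ) (hr : 2 ≤ r) (heven : Even r) (y : Fin r → ℂ)
    (h : ∀ i k : Fin r, i < k → y i * y k ≠ 1) :
    ∑ j ∈ Finset.univ.filter (fun j : Fin r => j ≠ ⟨0, by omega⟩),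
        (-1 : ℂ) ^ ((j : ℕ) + 1) *
          ((y ⟨0, by omega⟩ - y j) / (y ⟨0, by omega⟩ * y j - 1)) *
          ∏ p ∈ Finset.univ.filter
              (fun p : Fin r × Fin r =>
                p.1 < p.2 ∧ p.1 ≠ ⟨0, by omega⟩ ∧ p.1 ≠ j ∧ p.2 ≠ ⟨0, by omega⟩ ∧ p.2 ≠ j),
            (y p.1 - y p.2) / (y p.1 * y p.2 - 1) =
      ∏ p ∈ Finset.univ.filter (fun p : Fin r × Fin r => p.1 < p.2),
        (y p.1 - y p.2) / (y p.1 * y p.2 - 1) := by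
  obtain ⟨n, rfl⟩ : ∃ n, r = n + 1 := ⟨r - 1, by omega⟩
  have hn : Odd n := by
    rcases Nat.even_or_odd n with hn | hn
    · exact absurd heven (by simpa [Nat.even_add_one] using hn)
    · exact hn
  have hne : ∀ i k, i ≠ k → y i * y k ≠ 1 := fun i k hik => by
    rcases lt_or_gt_of_ne hik with hlt | hlt
    · exact h i k hlt
    · rw [mul_comm]; exact h k i hlt
  let g : ℂ → Fin (n + 1) → ℂ := fun e i => y i + e * ((i : ℕ) + 1)
  have hg0 : g 0 = y := by ext i; simp [g]
  have hgc : ∀ i, ContinuousAt (fun e => g e i) 0 := fun i => by simp only [g]; fun_prop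
  have hpos : ∀ i : Fin (n + 1), ((i : ℕ) : ℂ) + 1 ≠ 0 := fun i => by
    exact_mod_cast Nat.succ_ne_zero i
  have hfc : ∀ i k, i ≠ k →
      ContinuousAt (fun e => (g e i - g e k) / (g e i * g e k - 1)) 0 := fun i k hik =>
    ((hgc i).sub (hgc k)).div (((hgc i).mul (hgc k)).sub continuousAt_const)
      (by simpa [hg0] using sub_ne_zero.2 (hne i k hik))
  let L : (Fin (n + 1) → ℂ) → ℂ := fun z =>
    ∑ j ∈ Finset.univ.erase (0 : Fin (n + 1)),
      (-1 : ℂ) ^ ((j : ℕ) + 1) * ((z 0 - z j) / (z 0 * z j - 1)) *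
        ∏ p ∈ ((Finset.univ.erase 0).erase j) ×ˢ ((Finset.univ.erase 0).erase j)
          with p.1 < p.2, (z p.1 - z p.2) / (z p.1 * z p.2 - 1)
  let R : (Fin (n + 1) → ℂ) → ℂ := fun z =>
    ∏ p ∈ (Finset.univ : Finset (Fin (n + 1))) ×ˢ Finset.univ with p.1 < p.2,
      (z p.1 - z p.2) / (z p.1 * z p.2 - 1)
  have hgen : ∀ᶠ e in 𝓝[≠] (0 : ℂ), L (g e) = R (g e) := by
    have e1 : ∀ᶠ e in 𝓝[≠] (0 : ℂ), ∀ i k, i ≠ k → g e i * g e k ≠ 1 := by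
      refine eventually_all.2 fun i => eventually_all.2 fun k => ?_
      by_cases hik : i = k
      · simp [hik]
      · have := (((hgc i).mul (hgc k)).eventually_ne (by simpa [hg0] using hne i k hik) :
          ∀ᶠ e in 𝓝 (0 : ℂ), g e i * g e k ≠ 1)
        exact (this.filter_mono nhdsWithin_le_nhds).mono fun e he _ => he
    have e2 : ∀ᶠ e in 𝓝[≠] (0 : ℂ), ∀ i k, i ≠ k → g e i ≠ g e k := by
      refine eventually_all.2 fun i => eventually_all.2 fun k => ?_
      by_cases hik : i = k
      · simp [hik]
      · have hb : ((i : ℕ) : ℂ) - ((k : ℕ) : ℂ) ≠ 0 :=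
          sub_ne_zero.2 (by exact_mod_cast Fin.val_ne_of_ne hik)
        filter_upwards [eventually_add_mul_ne (y i - y k) _ 0 hb] with e he _ heq
        exact he (by simp only [g] at heq; linear_combination heq)
    have e3 (c : ℂ) : ∀ᶠ e in 𝓝[≠] (0 : ℂ), ∀ i, g e i ≠ c :=
      eventually_all.2 fun i => eventually_add_mul_ne _ _ c (hpos i)
    filter_upwards [e1, e2, e3 0, e3 1, e3 (-1)] with e he1 he2 he3 he4 he5
    exact alternating_sum_of_generic hn (g e) he1
      (fun i k hik => by_contra fun hne => he2 i k hne hik) (he3 0) he4 he5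
  have hL : Tendsto (fun e => L (g e)) (𝓝 0) (𝓝 (L (g 0))) :=
    tendsto_finsetSum _ fun j hj =>
      (tendsto_const_nhds.mul (hfc 0 j (Finset.ne_of_mem_erase hj).symm)).mul
        (tendsto_finsetProd _ fun p hp => hfc p.1 p.2 (Finset.mem_filter.1 hp).2.ne)
  have hR : Tendsto (fun e => R (g e)) (𝓝 0) (𝓝 (R (g 0))) :=
    tendsto_finsetProd _ fun p hp => hfc p.1 p.2 (Finset.mem_filter.1 hp).2.ne
  have hlim := tendsto_nhds_unique_of_eventuallyEq (hL.mono_left nhdsWithin_le_nhds)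
    (hR.mono_left nhdsWithin_le_nhds) hgen
  rw [hg0] at hlim
  convert hlim using 1
  · refine Finset.sum_congr (Finset.ext fun j => Finset.mem_filter.trans ?_) fun j _ => ?_
    · simp
    · congr 1
      refine Finset.prod_congr (Finset.ext fun p => Finset.mem_filter.trans ?_) fun _ _ => rfl
      simp only [Finset.mem_filter, Finset.mem_product, Finset.mem_erase, Finset.mem_univ,
        and_true, true_and, Fin.mk_zero']
      tauto
  · simp [R]
end

section
/- Let N ≥ 2 and let q ∈ ℂ be a primitive 4N-th root of unity with q^N = i. (i) For every strict partition λ = (λ₁ > … > λ_r > 0) with λ₁ ≤ N−1, all the factors q^j − q^{−j} (1 ≤ j ≤ λ₁) and [λ_i + λ_j] (i < j) appearing in the definition of q_λ are nonzero, and q_λ ≠ 0. (ii) For every strict partition λ with λ₁ = N+1 and λ₂ ≤ N−2, one has q_λ = 0. -/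
noncomputable section

/-- The quantum integer `[k] = (q^k - q^{-k})/(q - q⁻¹)`. -/
def qnum (q : ℂ) (k : ℤ) : ℂ := (q ^ k - q ^ (-k)) / (q - q⁻¹)

/-- The one-row quantity `q_{(m)} = ∏_{j=1}^m i (q^{j-1} + q^{1-j})/(q^j - q^{-j})`. -/
def qrow (q : ℂ) (m : ℕ) : ℂ :=
  ∏ j ∈ Finset.Icc 1 m,
    Complex.I * (q ^ ((j : ℤ) - 1) + q ^ (1 - (j : ℤ))) / (q ^ (j : ℤ) - q ^ (-(j : ℤ)))

/-- The quantity `q_λ` attached to a strict partition `λ = (λ₁ > … > λ_r > 0)`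
(given as a function `Fin r → ℕ`):
`q_λ = ∏_j q_{(λ_j)} ∏_{i<j} [λ_i - λ_j]/[λ_i + λ_j]`. -/
def qpart (q : ℂ) {r : ℕ} (lam : Fin r → ℕ) : ℂ :=
  (∏ j, qrow q (lam j)) *
    ∏ p ∈ Finset.univ.filter (fun p : Fin r × Fin r => p.1 < p.2),
      qnum q ((lam p.1 : ℤ) - (lam p.2 : ℤ)) / qnum q ((lam p.1 : ℤ) + (lam p.2 : ℤ))

end

/-- If `q` is a primitive `4N`-th root of unity, then `q^k ≠ q^{-k}` for `0 < |k| < 2N`. -/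
theorem IsPrimitiveRoot.zpow_sub_zpow_neg_ne_zero {N : ℕ} {q : ℂ}
    (hq : IsPrimitiveRoot q (4 * N)) {k : ℤ} (hk : k ≠ 0) (hkN : |k| < 2 * N) :
    q ^ k - q ^ (-k) ≠ 0 := by
  obtain ⟨h₁, h₂⟩ := abs_lt.mp hkN
  have hq0 : q ≠ 0 := hq.ne_zero (by omega)
  intro h
  have hone : q ^ (2 * k) = 1 := by
    rw [two_mul, zpow_add₀ hq0]
    nth_rewrite 1 [sub_eq_zero.mp h]
    rw [← zpow_add₀ hq0, neg_add_cancel, zpow_zero]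
  have hdvd := (hq.zpow_eq_one_iff_dvd _).mp hone
  have hle := Int.le_of_dvd (abs_pos.mpr (by omega : 2 * k ≠ 0)) ((dvd_abs _ _).mpr hdvd)
  rw [abs_mul, abs_two] at hle
  push_cast at hle
  omega

/-- If `q` is a primitive `4N`-th root of unity, then `q^k + q^{-k} ≠ 0` for `|k| < N`. -/
theorem IsPrimitiveRoot.zpow_add_zpow_neg_ne_zero {N : ℕ} {q : ℂ}
    (hq : IsPrimitiveRoot q (4 * N)) {k : ℤ} (hkN : |k| < N) :
    q ^ k + q ^ (-k) ≠ 0 := by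
  obtain ⟨h₁, h₂⟩ := abs_lt.mp hkN
  have hq0 : q ≠ 0 := hq.ne_zero (by omega)
  rcases eq_or_ne k 0 with rfl | hk
  · norm_num
  intro h
  refine hq.zpow_sub_zpow_neg_ne_zero (k := 2 * k) (by omega)
    (abs_lt.mpr ⟨by omega, by omega⟩) ?_
  rw [two_mul, neg_add, zpow_add₀ hq0, zpow_add₀ hq0]
  linear_combination (q ^ k - q ^ (-k)) * h

theorem qnum_ne_zero {N : ℕ} {q : ℂ} (hN : 1 ≤ N) (hq : IsPrimitiveRoot q (4 * N))
    {k : ℤ} (hk : k ≠ 0) (hkN : |k| < 2 * N) : qnum q k ≠ 0 := by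
  have h := hq.zpow_sub_zpow_neg_ne_zero (k := 1) one_ne_zero (by rw [abs_one]; omega)
  rw [zpow_one, zpow_neg_one] at h
  exact div_ne_zero (hq.zpow_sub_zpow_neg_ne_zero hk hkN) h

theorem qrow_ne_zero {N m : ℕ} {q : ℂ} (hq : IsPrimitiveRoot q (4 * N)) (hm : m ≤ N) :
    qrow q m ≠ 0 := by
  refine Finset.prod_ne_zero_iff.mpr fun j hj => ?_
  obtain ⟨hj₁, hj₂⟩ := Finset.mem_Icc.mp hj
  have h := hq.zpow_add_zpow_neg_ne_zero (k := (j : ℤ) - 1) (abs_lt.mpr ⟨by omega, by omega⟩)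
  rw [neg_sub] at h
  exact div_ne_zero (mul_ne_zero Complex.I_ne_zero h)
    (hq.zpow_sub_zpow_neg_ne_zero (by omega) (abs_lt.mpr ⟨by omega, by omega⟩))

/-- If `q^N = i`, the factor `q^N + q^{-N}` makes `q_{(m)}` vanish for `m > N`. -/
theorem qrow_eq_zero {N m : ℕ} {q : ℂ} (hqN : q ^ N = Complex.I) (hm : N < m) :
    qrow q m = 0 := by
  refine Finset.prod_eq_zero (i := N + 1) (Finset.mem_Icc.mpr ⟨by omega, hm⟩) ?_
  have h₁ : ((N + 1 : ℕ) : ℤ) - 1 = N := by push_cast; ring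
  have h₂ : 1 - ((N + 1 : ℕ) : ℤ) = -N := by push_cast; ring
  rw [h₁, h₂, zpow_neg, zpow_natCast, hqN, Complex.inv_I, add_neg_cancel, mul_zero, zero_div]

/-- let `q` be a primitive `4N`-th root of unity with `q^N = i`.
(i) For every strict partition `λ` with `λ₁ ≤ N-1`, the factors `q^j - q^{-j}`
(`1 ≤ j ≤ λ₁`) and `[λ_i + λ_j]` (`i < j`) are nonzero, and `q_λ ≠ 0`.
(ii) For every strict partition `λ` with `λ₁ = N+1` and `λ₂ ≤ N-2`, `q_λ = 0`. -/
theorem qpart_vanishing (N : ℕ) (hN : 2 ≤ N) (q : ℂ)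
    (hq : IsPrimitiveRoot q (4 * N)) (hqN : q ^ N = Complex.I) :
    (∀ (r : ℕ) (hr : 0 < r) (lam : Fin r → ℕ),
      (∀ i j : Fin r, i < j → lam j < lam i) → (∀ i, 0 < lam i) →
      lam ⟨0, hr⟩ ≤ N - 1 →
      ((∀ j : ℕ, 1 ≤ j → j ≤ lam ⟨0, hr⟩ → q ^ (j : ℤ) - q ^ (-(j : ℤ)) ≠ 0) ∧
       (∀ i j : Fin r, i < j → qnum q ((lam i : ℤ) + (lam j : ℤ)) ≠ 0) ∧
       qpart q lam ≠ 0)) ∧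
    (∀ (r : ℕ) (hr : 2 ≤ r) (lam : Fin r → ℕ),
      (∀ i j : Fin r, i < j → lam j < lam i) → (∀ i, 0 < lam i) →
      lam ⟨0, by omega⟩ = N + 1 → lam ⟨1, hr⟩ ≤ N - 2 →
      qpart q lam = 0) := by
  refine ⟨fun r hr lam hlam hpos hle => ?_, fun r hr lam _ _ h₀ _ => ?_⟩
  · have hbound : ∀ i, lam i ≤ N - 1 := fun i => by
      rcases (Fin.mk_le_of_le_val (Nat.zero_le i) : (⟨0, hr⟩ : Fin r) ≤ i).eq_or_lt with h | h
      · rwa [← h]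
      · exact (hlam _ _ h).le.trans hle
    have hadd : ∀ i j : Fin r, i < j → qnum q ((lam i : ℤ) + (lam j : ℤ)) ≠ 0 := by
      intro i j _
      have hi := hbound i
      have hj := hbound j
      have := hpos i
      exact qnum_ne_zero (by omega) hq (by omega) (abs_lt.mpr ⟨by omega, by omega⟩)
    refine ⟨fun j hj₁ hj₂ => hq.zpow_sub_zpow_neg_ne_zero (by omega)
      (abs_lt.mpr ⟨by omega, by omega⟩), hadd, mul_ne_zero ?_ ?_⟩
    · exact Finset.prod_ne_zero_iff.mpr fun j _ =>
        qrow_ne_zero hq ((hbound j).trans (Nat.sub_le N 1))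
    · refine Finset.prod_ne_zero_iff.mpr fun p hp => ?_
      have hlt := (Finset.mem_filter.mp hp).2
      have h := hlam _ _ hlt
      have hp₁ := hbound p.1
      exact div_ne_zero (qnum_ne_zero (by omega) hq (by omega)
        (abs_lt.mpr ⟨by omega, by omega⟩)) (hadd _ _ hlt)
  · refine mul_eq_zero_of_left (Finset.prod_eq_zero (Finset.mem_univ ⟨0, by omega⟩) ?_) _
    exact qrow_eq_zero hqN (by omega)
end

section
/- Let q ∈ ℂ be nonzero and not a root of unity, and let λ be a strict partition with ℓ(λ) parts. Then q_{(1)} · q_λ = Σ_μ 2^{ℓ(λ) − ℓ(μ) + 1} · q_μ, where the sum is over all strict partitions μ obtained from λ by adding a single box (i.e., μ is strict, contains λ, and |μ| = |λ| + 1); here q_{(1)} = 2i/(q − q^{−1}), and the coefficient is 2 when ℓ(μ) = ℓ(λ) and 1 when ℓ(μ) = ℓ(λ) + 1. -/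
/-- A strict partition, presented as a function `Fin r → ℕ`: strictly decreasing with
all parts positive. -/
def IsStrictPartition {r : ℕ} (lam : Fin r → ℕ) : Prop :=
  (∀ i j : Fin r, i < j → lam j < lam i) ∧ ∀ i, 0 < lam i

instance {r : ℕ} (lam : Fin r → ℕ) : Decidable (IsStrictPartition lam) :=
  inferInstanceAs
    (Decidable ((∀ i j : Fin r, i < j → lam j < lam i) ∧ ∀ i, 0 < lam i))

open Finset

/-- Partial fractions for a quotient of two monic products, evaluated at the extra node `c`. -/
theorem one_eq_sum_prod_sub_div {F ι : Type*} [Field F] [Fintype ι] [DecidableEq ι] (u v : ι → F)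
    (c : F) (hu : Function.Injective u) (hc : ∀ i, u i ≠ c) :
    1 = (∑ k, (u k - v k) / (u k - c) *
        ∏ j, if j = k then 1 else (u k - v j) / (u k - u j)) +
      ∏ j, (c - v j) / (c - u j) := by
  let P : Polynomial F := ∏ j, (Polynomial.X - Polynomial.C (v j))
  let w : Option ι → F := fun o => o.elim c u
  have hw : Function.Injective w := by
    rintro (_ | i) (_ | j) h
    · rfl
    · exact absurd h.symm (hc j)
    · exact absurd h (hc i)
    · exact congrArg some (hu h)
  have hP : P.Monic := Polynomial.monic_prod_X_sub_C v univ
  have hdeg : P.degree = (Fintype.card ι : WithBot ℕ) := by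
    rw [Polynomial.degree_eq_natDegree hP.ne_zero, Polynomial.natDegree_finsetProd_X_sub_C_eq_card]
    simp
  have key := Lagrange.leadingCoeff_eq_sum (s := univ) (v := w) hw.injOn (P := P)
    (by rw [hdeg]; simp)
  have erase_prod : ∀ (i : Option ι) (f : Option ι → F),
      ∏ j ∈ univ.erase i, f j = ∏ j, if j = i then 1 else f j := by
    intro i f
    rw [← prod_erase (a := i) univ (f := fun j => if j = i then 1 else f j) (by simp)]
    exact prod_congr rfl fun j hj => by simp [ne_of_mem_erase hj]
  rw [hP.leadingCoeff, Fintype.sum_option, add_comm] at key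
  refine key.trans ?_
  congr 1
  · refine sum_congr rfl fun k _ => ?_
    rw [erase_prod, Fintype.prod_option]
    have hsplit : P.eval (u k) = (u k - v k) * ∏ j, if j = k then 1 else (u k - v j) := by
      simp only [P, Polynomial.eval_prod, Polynomial.eval_sub, Polynomial.eval_X,
        Polynomial.eval_C]
      rw [← mul_prod_erase univ _ (mem_univ k)]
      congr 1
      rw [← prod_erase (a := k) univ (f := fun j => if j = k then 1 else u k - v j) (by simp)]
      exact prod_congr rfl fun j hj => by simp [ne_of_mem_erase hj]
    simp only [w, Option.elim, reduceCtorEq, if_false, Option.some_inj]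
    rw [hsplit, mul_div_mul_comm, ← prod_div_distrib]
    congr 1
    exact prod_congr rfl fun j _ => by split_ifs <;> simp
  · rw [erase_prod, Fintype.prod_option]
    simp [w, P, Polynomial.eval_prod, prod_div_distrib]

theorem prod_ordered_pairs_ite {M ι : Type*} [CommMonoid M] [Fintype ι] [LinearOrder ι] (k : ι)
    (h : ι → M) :
    ∏ p ∈ univ.filter (fun p : ι × ι => p.1 < p.2),
        (if p.1 = k then h p.2 else if p.2 = k then h p.1 else 1) =
      ∏ j, if j = k then 1 else h j := by
  have hsplit : ∀ a b : ι,
      (if a < b then (if a = k then h b else if b = k then h a else 1) else 1) =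
        (if a = k then (if k < b then h b else 1) else 1) *
          (if b = k then (if a < k then h a else 1) else 1) := by
    intro a b
    by_cases ha : a = k
    · subst ha
      by_cases hb : b = a <;> simp [hb]
    · by_cases hb : b = k
      · subst hb
        simp [ha]
      · simp [ha, hb]
  rw [prod_filter, Fintype.prod_prod_type]
  simp only [hsplit, prod_mul_distrib, prod_ite_eq', mem_univ, if_true]
  rw [prod_comm]
  simp only [prod_ite_eq', mem_univ, if_true]
  rw [← prod_mul_distrib]
  refine prod_congr rfl fun j _ => ?_
  rcases lt_trichotomy j k with hj | hj | hj
  · simp [hj, hj.ne, hj.not_gt]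
  · simp [hj]
  · simp [hj, hj.ne', hj.not_gt]

theorem zpow_ne_one_of_pow_ne_one {q : ℂ} (hq : ∀ k : ℕ, 0 < k → q ^ k ≠ 1) {n : ℤ} (hn : n ≠ 0) :
    q ^ n ≠ 1 := by
  intro h
  refine hq n.natAbs (Int.natAbs_pos.mpr hn) ?_
  rcases Int.natAbs_eq n with h' | h'
  · rw [h', zpow_natCast] at h
    exact h
  · rw [h', zpow_neg, zpow_natCast, inv_eq_one] at h
    exact h

theorem zpow_sub_zpow_neg_ne_zero {q : ℂ} (hq0 : q ≠ 0) (hq : ∀ k : ℕ, 0 < k → q ^ k ≠ 1) {n : ℤ}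
    (hn : n ≠ 0) : q ^ n - q ^ (-n) ≠ 0 := by
  intro h
  refine zpow_ne_one_of_pow_ne_one hq (n := n + n) (by omega) ?_
  rw [zpow_add₀ hq0]
  nth_rewrite 1 [sub_eq_zero.mp h]
  rw [← zpow_add₀ hq0, neg_add_cancel, zpow_zero]

theorem sub_inv_ne_zero_of_pow_ne_one {q : ℂ} (hq0 : q ≠ 0) (hq : ∀ k : ℕ, 0 < k → q ^ k ≠ 1) :
    q - q⁻¹ ≠ 0 := by
  simpa using zpow_sub_zpow_neg_ne_zero hq0 hq one_ne_zero

theorem qnum_ne_zero_s18 {q : ℂ} (hq0 : q ≠ 0) (hq : ∀ k : ℕ, 0 < k → q ^ k ≠ 1) {n : ℤ}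
    (hn : n ≠ 0) : qnum q n ≠ 0 :=
  div_ne_zero (zpow_sub_zpow_neg_ne_zero hq0 hq hn) (sub_inv_ne_zero_of_pow_ne_one hq0 hq)

theorem qnum_zero (q : ℂ) : qnum q 0 = 0 := by simp [qnum]

theorem qnum_neg (q : ℂ) (n : ℤ) : qnum q (-n) = -qnum q n := by
  simp only [qnum, neg_neg]
  ring

theorem sq_mul_qnum_mul_qnum {q : ℂ} (hq0 : q ≠ 0) (hq1 : q - q⁻¹ ≠ 0) {a b s t : ℤ}
    (ha : a = s + t) (hb : b = s - t) :
    (q ^ a + q ^ (-a)) - (q ^ b + q ^ (-b)) = (q - q⁻¹) ^ 2 * qnum q s * qnum q t := by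
  have hmul : (q - q⁻¹) ^ 2 * qnum q s * qnum q t =
      (q ^ s - q ^ (-s)) * (q ^ t - q ^ (-t)) := by
    unfold qnum
    generalize q - q⁻¹ = d at *
    field_simp
  rw [hmul, ha, hb, sub_mul, mul_sub, mul_sub, ← zpow_add₀ hq0, ← zpow_add₀ hq0, ← zpow_add₀ hq0,
    ← zpow_add₀ hq0, neg_add, neg_sub, sub_eq_add_neg s t, sub_eq_add_neg t s, add_comm t (-s)]
  ring

theorem qrow_one {q : ℂ} : qrow q 1 = 2 * (Complex.I / (q - q⁻¹)) := by
  simp [qrow]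
  ring

theorem qrow_succ (q : ℂ) (m : ℕ) :
    qrow q (m + 1) = qrow q m *
      (Complex.I * (q ^ (m : ℤ) + q ^ (-(m : ℤ))) / (q ^ ((m : ℤ) + 1) - q ^ (-((m : ℤ) + 1)))) := by
  rw [qrow, prod_Icc_succ_top (by omega), ← qrow]
  push_cast
  rw [add_sub_cancel_right, show (1 : ℤ) - (m + 1) = -m by ring]

theorem qpart_eq_zero_of_eq (q : ℂ) {r : ℕ} (μ : Fin r → ℕ) {i j : Fin r} (hij : i < j)
    (h : μ i = μ j) : qpart q μ = 0 := by
  refine mul_eq_zero_of_right _ (prod_eq_zero (i := (i, j)) (by simpa using hij) ?_)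
  simp [h, qnum_zero]

/-- A weakly decreasing positive sequence which is not strict contributes zero. -/
theorem ite_isStrictPartition_qpart (q c : ℂ) {r : ℕ} (μ : Fin r → ℕ)
    (hle : ∀ i j, i < j → μ j ≤ μ i) (hpos : ∀ i, 0 < μ i) :
    (if IsStrictPartition μ then c * qpart q μ else 0) = c * qpart q μ := by
  split_ifs with h
  · rfl
  · have hne : ∃ i j, i < j ∧ μ i = μ j := by
      by_contra! hcon
      exact h ⟨fun i j hij => lt_of_le_of_ne (hle i j hij) (hcon i j hij).symm, hpos⟩
    obtain ⟨i, j, hij, heq⟩ := hne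
    rw [qpart_eq_zero_of_eq q μ hij heq, mul_zero]

theorem qpart_snoc_one (q : ℂ) {r : ℕ} (lam : Fin r → ℕ) :
    qpart q (Fin.snoc lam 1 : Fin (r + 1) → ℕ) = qrow q 1 * qpart q lam *
      ∏ j, qnum q ((lam j : ℤ) - 1) / qnum q ((lam j : ℤ) + 1) := by
  unfold qpart
  rw [prod_filter, prod_filter, Fintype.prod_prod_type, Fintype.prod_prod_type]
  simp only [Fin.prod_univ_castSucc, Fin.snoc_castSucc, Fin.snoc_last, Fin.castSucc_lt_last,
    Fin.castSucc_lt_castSucc_iff, prod_mul_distrib, if_true, lt_self_iff_false, if_false,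
    (Fin.castSucc_lt_last _).not_gt, prod_const_one, Nat.cast_one]
  ring

theorem qpart_add_single {q : ℂ} (hq0 : q ≠ 0) (hq : ∀ k : ℕ, 0 < k → q ^ k ≠ 1) {r : ℕ}
    (lam : Fin r → ℕ) (hlam : IsStrictPartition lam) (k : Fin r) :
    qpart q (fun i => if i = k then lam i + 1 else lam i) = qpart q lam *
      ((Complex.I * (q ^ (lam k : ℤ) + q ^ (-(lam k : ℤ))) /
        (q ^ ((lam k : ℤ) + 1) - q ^ (-((lam k : ℤ) + 1)))) *
      ∏ j, if j = k then 1 else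
        qnum q ((lam k : ℤ) + lam j) * qnum q ((lam k : ℤ) - lam j + 1) /
          (qnum q ((lam k : ℤ) + lam j + 1) * qnum q ((lam k : ℤ) - lam j))) := by
  have hrow : ∏ j, qrow q (if j = k then lam j + 1 else lam j) =
      (∏ j, qrow q (lam j)) * (Complex.I * (q ^ (lam k : ℤ) + q ^ (-(lam k : ℤ))) /
        (q ^ ((lam k : ℤ) + 1) - q ^ (-((lam k : ℤ) + 1)))) := by
    have : ∀ j, qrow q (if j = k then lam j + 1 else lam j) = qrow q (lam j) *
        (if j = k then (Complex.I * (q ^ (lam j : ℤ) + q ^ (-(lam j : ℤ))) /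
        (q ^ ((lam j : ℤ) + 1) - q ^ (-((lam j : ℤ) + 1)))) else 1) := by
      intro j
      split_ifs
      · exact qrow_succ q _
      · simp
    simp only [this, prod_mul_distrib, prod_ite_eq', mem_univ, if_true]
  unfold qpart
  rw [hrow, ← prod_ordered_pairs_ite k]
  rw [mul_mul_mul_comm, ← prod_mul_distrib]
  congr 1
  refine prod_congr rfl fun ⟨a, b⟩ hp => ?_
  have hab : a < b := by simpa using hp
  have hlt := hlam.1 a b hab
  have hb := hlam.2 b
  have h1 : qnum q ((lam a : ℤ) - lam b) ≠ 0 := qnum_ne_zero_s18 hq0 hq (by omega)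
  have h2 : qnum q ((lam a : ℤ) + lam b) ≠ 0 := qnum_ne_zero_s18 hq0 hq (by omega)
  have h3 : qnum q ((lam a : ℤ) + lam b + 1) ≠ 0 := qnum_ne_zero_s18 hq0 hq (by omega)
  dsimp only
  by_cases ha : a = k
  · subst ha
    simp only [if_true, hab.ne', if_false]
    push_cast
    rw [show (lam a : ℤ) + 1 - lam b = lam a - lam b + 1 by ring,
      show (lam a : ℤ) + 1 + lam b = lam a + lam b + 1 by ring]
    field_simp
  · by_cases hb : b = k
    · subst hb
      simp only [if_true, ha, if_false]
      push_cast
      rw [show (lam a : ℤ) - (lam b + 1) = -(lam b - lam a + 1) by ring,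
        show (lam a : ℤ) + (lam b + 1) = lam a + lam b + 1 by ring,
        show (lam b : ℤ) - lam a = -(lam a - lam b) by ring, qnum_neg, qnum_neg,
        add_comm (lam b : ℤ)]
      field_simp
    · simp [ha, hb]

/-- for `q` nonzero and not a root of unity and a strict partition `λ`,
`q_{(1)} q_λ = Σ_μ 2^{ℓ(λ) - ℓ(μ) + 1} q_μ`, the sum being over all strict `μ` obtained
from `λ` by adding one box.  Adding a box either increments one part (then
`ℓ(μ) = ℓ(λ)` and the coefficient is `2 = 2^{ℓ(λ)-ℓ(μ)+1}`), or appends a new part equal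
to `1` (then `ℓ(μ) = ℓ(λ) + 1` and the coefficient is `1 = 2^{ℓ(λ)-ℓ(μ)+1}`); a summand
appears precisely when the resulting `μ` is again a strict partition. -/
theorem qrow_one_mul_qpart (q : ℂ) (hq0 : q ≠ 0) (hq : ∀ k : ℕ, 0 < k → q ^ k ≠ 1)
    (r : ℕ) (lam : Fin r → ℕ) (hlam : IsStrictPartition lam) :
    qrow q 1 * qpart q lam =
      (∑ k : Fin r,
        if IsStrictPartition (fun i => if i = k then lam i + 1 else lam i) then
          2 * qpart q (fun i => if i = k then lam i + 1 else lam i)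
        else 0) +
      (if IsStrictPartition (Fin.snoc lam 1 : Fin (r + 1) → ℕ) then
          qpart q (Fin.snoc lam 1 : Fin (r + 1) → ℕ)
        else 0) := by
  have hq1 := sub_inv_ne_zero_of_pow_ne_one hq0 hq
  have hsnoc := ite_isStrictPartition_qpart q 1 (Fin.snoc lam 1 : Fin (r + 1) → ℕ)
    (by
      intro i j hij
      induction i using Fin.lastCases with
      | last => exact absurd hij (Fin.le_last j).not_gt
      | cast i =>
        induction j using Fin.lastCases with
        | last => simpa [Nat.one_le_iff_ne_zero, Nat.pos_iff_ne_zero] using hlam.2 i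
        | cast j => simpa using (hlam.1 i j (by simpa using hij)).le)
    (by
      intro i
      induction i using Fin.lastCases with
      | last => simp
      | cast i => simpa using hlam.2 i)
  rw [one_mul] at hsnoc
  rw [hsnoc, qpart_snoc_one]
  let u : Fin r → ℂ := fun j => q ^ (2 * (lam j : ℤ) + 1) + q ^ (-(2 * (lam j : ℤ) + 1))
  let v : Fin r → ℂ := fun j => q ^ (2 * (lam j : ℤ) - 1) + q ^ (-(2 * (lam j : ℤ) - 1))
  let c : ℂ := q ^ (1 : ℤ) + q ^ (-(1 : ℤ))
  have huu : ∀ k j, u k - u j =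
      (q - q⁻¹) ^ 2 * qnum q ((lam k : ℤ) + lam j + 1) * qnum q ((lam k : ℤ) - lam j) :=
    fun k j => sq_mul_qnum_mul_qnum hq0 hq1 (by ring) (by ring)
  have huv : ∀ k j, u k - v j =
      (q - q⁻¹) ^ 2 * qnum q ((lam k : ℤ) + lam j) * qnum q ((lam k : ℤ) - lam j + 1) :=
    fun k j => sq_mul_qnum_mul_qnum hq0 hq1 (by ring) (by ring)
  have huc : ∀ k, u k - c = (q - q⁻¹) ^ 2 * qnum q ((lam k : ℤ) + 1) * qnum q (lam k) :=
    fun k => sq_mul_qnum_mul_qnum hq0 hq1 (by ring) (by ring)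
  have hvc : ∀ k, v k - c = (q - q⁻¹) ^ 2 * qnum q (lam k) * qnum q ((lam k : ℤ) - 1) :=
    fun k => sq_mul_qnum_mul_qnum hq0 hq1 (by ring) (by ring)
  have hn0 : ∀ k, qnum q (lam k) ≠ 0 := fun k =>
    qnum_ne_zero_s18 hq0 hq (by have := hlam.2 k; omega)
  have hn1 : ∀ k, qnum q ((lam k : ℤ) + 1) ≠ 0 := fun k => qnum_ne_zero_s18 hq0 hq (by omega)
  have hc : ∀ k, u k ≠ c := by
    intro k
    rw [← sub_ne_zero, huc]
    exact mul_ne_zero (mul_ne_zero (pow_ne_zero 2 hq1) (hn1 k)) (hn0 k)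
  have hu : Function.Injective u := by
    intro k j hkj
    by_contra hne
    have hlamne : lam k ≠ lam j := by
      rcases lt_or_gt_of_ne hne with h | h
      · exact (hlam.1 _ _ h).ne'
      · exact (hlam.1 _ _ h).ne
    refine absurd (sub_eq_zero.mpr hkj) ?_
    rw [huu]
    exact mul_ne_zero (mul_ne_zero (pow_ne_zero 2 hq1) (qnum_ne_zero_s18 hq0 hq (by omega)))
      (qnum_ne_zero_s18 hq0 hq (by omega))
  have hsum : ∀ k : Fin r,
      (if IsStrictPartition (fun i => if i = k then lam i + 1 else lam i) then
          2 * qpart q (fun i => if i = k then lam i + 1 else lam i)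
        else 0) = qrow q 1 * qpart q lam * ((u k - v k) / (u k - c) *
        ∏ j, if j = k then 1 else (u k - v j) / (u k - u j)) := by
    intro k
    rw [ite_isStrictPartition_qpart, qpart_add_single hq0 hq lam hlam, qrow_one]
    · have hprod : (∏ j, if j = k then 1 else (u k - v j) / (u k - u j)) =
          ∏ j, if j = k then 1 else
            qnum q ((lam k : ℤ) + lam j) * qnum q ((lam k : ℤ) - lam j + 1) /
              (qnum q ((lam k : ℤ) + lam j + 1) * qnum q ((lam k : ℤ) - lam j)) := by
        refine prod_congr rfl fun j _ => ?_
        split_ifs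
        · rfl
        · rw [huv, huu, mul_assoc, mul_assoc, mul_div_mul_left _ _ (pow_ne_zero 2 hq1)]
      have hcoef : Complex.I * (q ^ (lam k : ℤ) + q ^ (-(lam k : ℤ))) /
          (q ^ ((lam k : ℤ) + 1) - q ^ (-((lam k : ℤ) + 1))) =
          Complex.I / (q - q⁻¹) * ((u k - v k) / (u k - c)) := by
        have h2 : qnum q ((lam k : ℤ) + lam k) =
            qnum q (lam k) * (q ^ (lam k : ℤ) + q ^ (-(lam k : ℤ))) := by
          simp only [qnum, neg_add, zpow_add₀ hq0]
          ring
        have hone : qnum q 1 = 1 := by simp [qnum, hq1]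
        have hdiff : q ^ ((lam k : ℤ) + 1) - q ^ (-((lam k : ℤ) + 1)) =
            (q - q⁻¹) * qnum q ((lam k : ℤ) + 1) := (mul_div_cancel₀ _ hq1).symm
        rw [huv, huc, sub_self, zero_add, hone, h2, hdiff]
        have := hn0 k
        have := hn1 k
        generalize q - q⁻¹ = d at *
        field_simp
      rw [hprod, hcoef]
      ring
    · intro i j hij
      have := hlam.1 i j hij
      split_ifs <;> omega
    · intro i
      have := hlam.2 i
      split_ifs <;> omega
  have hlast : ∏ j, qnum q ((lam j : ℤ) - 1) / qnum q ((lam j : ℤ) + 1) =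
      ∏ j, (c - v j) / (c - u j) := by
    refine prod_congr rfl fun j _ => ?_
    rw [← neg_sub (v j), ← neg_sub (u j), neg_div_neg_eq, hvc, huc, mul_assoc, mul_assoc,
      mul_div_mul_left _ _ (pow_ne_zero 2 hq1), mul_comm (qnum q ((lam j : ℤ) + 1)),
      mul_div_mul_left _ _ (hn0 j)]
  simp only [hsum]
  rw [hlast, ← mul_sum, ← mul_add, ← one_eq_sum_prod_sub_div u v c hu hc, mul_one]
end
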